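/- arXiv:1302.1687 — 8 statements merged into one kernel-verified Lean document; each statement's English description precedes it below -/
import Mathlib

section
/- For every integer r ≥ 2 and every positive integer n, the maximum of Σ_{i=1}^n C(d_i, 2), taken over all simple graphs on n vertices with degree sequence d_1,…,d_n containing no K_{r+1} as a subgraph, equals Σ_v C(d_{T_r(n)}(v), 2), the corresponding sum for the Turán graph T_r(n). (This is the case k = 2 of Theorem 1.) -/
open Finset
open scoped Classical

/-- `e_φ(G) = Σ_v C(deg_G(v), k)`, the sum of `k`-th binomial coefficients of the degrees. -/
noncomputable def ePhi {V : Type*} [Fintype V] (G : SimpleGraph V) (k : ℕ) : ℕ :=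
  ∑ v, (G.degree v).choose k

/-- Erdős' degree majorization: a graph that is `K_{r+1}`-free on `S` has its degrees inside `S`
dominated by those of a complete `r`-partite graph on `S`. -/
theorem exists_coloring_degree_le {V : Type*} (G : SimpleGraph V) (r : ℕ) (S : Finset V)
    (hS : G.CliqueFreeOn S (r + 1)) :
    ∃ c : V → ℕ, (∀ v ∈ S, c v < r) ∧
      ∀ v ∈ S, #{u ∈ S | G.Adj v u} ≤ #{u ∈ S | c u ≠ c v} := by
  induction r generalizing S with
  | zero =>
    have hempty (v : V) : v ∉ S := fun hv =>
      hS (t := {v}) (by simpa using hv) (by simp [SimpleGraph.isNClique_iff])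
    exact ⟨fun _ => 0, fun v hv => (hempty v hv).elim, fun v hv => (hempty v hv).elim⟩
  | succ r ih =>
    obtain rfl | hne := S.eq_empty_or_nonempty
    · exact ⟨fun _ => 0, by simp, by simp⟩
    obtain ⟨v, hv, hmax⟩ := S.exists_max_image (fun v => #{u ∈ S | G.Adj v u}) hne
    set T := {u ∈ S | G.Adj v u} with hT
    have hTS : T ⊆ S := filter_subset _ _
    obtain ⟨c, hc, hdeg⟩ := ih T (by
      intro t ht hcl
      refine hS (t := insert v t) ?_ (hcl.insert fun b hb => (mem_filter.1 (ht hb)).2)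
      rw [coe_insert]
      exact Set.insert_subset hv (ht.trans (by exact_mod_cast hTS)))
    refine ⟨fun u => if u ∈ T then c u else r, fun u _ => ?_, fun u hu => ?_⟩
    · by_cases huT : u ∈ T
      · simpa [huT] using (hc u huT).trans (Nat.lt_succ_self r)
      · simp [huT]
    · by_cases huT : u ∈ T
      · calc #{w ∈ S | G.Adj u w} ≤ #({w ∈ T | G.Adj u w} ∪ (S \ T)) := by
              refine card_le_card fun w hw => ?_
              simp only [mem_filter, mem_union, mem_sdiff] at hw ⊢
              tauto
          _ ≤ #{w ∈ T | G.Adj u w} + #(S \ T) := card_union_le _ _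
          _ ≤ #{w ∈ T | c w ≠ c u} + #(S \ T) := Nat.add_le_add_right (hdeg u huT) _
          _ = #({w ∈ T | c w ≠ c u} ∪ (S \ T)) := by
              refine (card_union_of_disjoint ?_).symm
              exact disjoint_sdiff.mono_left (filter_subset _ _)
          _ ≤ _ := by
              refine card_le_card fun w hw => ?_
              have hcu := hc u huT
              simp only [mem_filter, mem_union, mem_sdiff] at hw ⊢
              rcases hw with ⟨hwT, hw⟩ | ⟨hwS, hwT⟩
              · exact ⟨hTS hwT, by simpa [hwT, huT] using hw⟩
              · exact ⟨hwS, by simpa [hwT, huT] using hcu.ne'⟩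
      · refine (hmax u hu).trans (card_le_card fun w hw => mem_filter.2 ⟨hTS hw, ?_⟩)
        simpa [hw, huT] using (hc w hw).ne

/-- Twice the sum of `C(d, 2)` over a complete multipartite graph, in terms of its part sizes. -/
theorem two_mul_sum_choose_two_multipartite {V : Type*} [Fintype V] {r : ℕ} (c : V → ℕ)
    (hc : ∀ v, c v < r) :
    2 * ((∑ v, (#{u | c u ≠ c v}).choose 2 : ℕ) : ℤ) =
      ∑ i ∈ range r, (#{u | c u = i} : ℤ) * (Fintype.card V - #{u | c u = i}) *
        (Fintype.card V - #{u | c u = i} - 1) := by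
  have hchoose (d : ℕ) : 2 * ((d.choose 2 : ℕ) : ℤ) = d * (d - 1) := by
    qify
    rw [Nat.cast_choose_two]
    ring
  have hcompl (i : ℕ) : (#{u | c u ≠ i} : ℤ) = Fintype.card V - #{u | c u = i} := by
    have := card_filter_add_card_filter_not (s := (univ : Finset V)) (fun u => c u = i)
    rw [card_univ] at this
    rw [← this]
    push_cast
    ring
  rw [Nat.cast_sum, mul_sum, ← sum_fiberwise_of_maps_to (t := range r) (g := c) (by simpa using hc)]
  refine sum_congr rfl fun i _ => ?_
  rw [sum_congr rfl (g := fun _ => ((Fintype.card V : ℤ) - #{u | c u = i}) *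
    (Fintype.card V - #{u | c u = i} - 1)), sum_const, nsmul_eq_mul, mul_assoc]
  intro v hv
  rw [hchoose, hcompl, (mem_filter.1 hv).2]

/-- Balanced part sizes maximize the sum of `m (n - m) (n - m - 1)`. -/
theorem sum_mul_sub_mul_sub_le_of_balanced {ι : Type*} (s : Finset ι) {n q : ℕ} (m t : ι → ℕ)
    (hq : 2 * q + 1 ≤ n) (hm : ∀ i ∈ s, m i + 1 ≤ n) (hmn : ∑ i ∈ s, m i = n)
    (htn : ∑ i ∈ s, t i = n) (ht : ∀ i ∈ s, t i = q ∨ t i = q + 1) :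
    ∑ i ∈ s, (m i : ℤ) * (n - m i) * (n - m i - 1) ≤
      ∑ i ∈ s, (t i : ℤ) * (n - t i) * (n - t i - 1) := by
  obtain ⟨ρ, hρ⟩ : ∃ ρ : ℤ, ρ = 2 * n - 2 - 2 * q := ⟨_, rfl⟩
  obtain ⟨a, ha⟩ : ∃ a : ℤ, a = n * (n - 1) - q * (q + 1) - (2 * q + 1) * ρ := ⟨_, rfl⟩
  have hg (x : ℤ) : x * (n - x) * (n - x - 1) =
      (a * x + q * (q + 1) * ρ) + (x - q) * (x - q - 1) * (x - ρ) := by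
    subst ha hρ; ring
  have hline (x : ι → ℕ) (hx : ∑ i ∈ s, x i = n) :
      ∑ i ∈ s, (a * (x i : ℤ) + q * (q + 1) * ρ) = a * n + #s * (q * (q + 1) * ρ) := by
    rw [sum_add_distrib, ← mul_sum, ← Nat.cast_sum, hx, sum_const, nsmul_eq_mul]
  calc _ ≤ ∑ i ∈ s, (a * (m i : ℤ) + q * (q + 1) * ρ) := by
        refine sum_le_sum fun i hi => ?_
        rw [hg]
        have h1 : (0 : ℤ) ≤ ((m i : ℤ) - q) * (m i - q - 1) := by
          rcases le_or_gt (m i) q with h | h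
          · exact mul_nonneg_of_nonpos_of_nonpos (by lia) (by lia)
          · exact mul_nonneg (by lia) (by lia)
        have := mul_nonpos_of_nonneg_of_nonpos h1 (b := (m i : ℤ) - ρ) (by have := hm i hi; lia)
        linarith
    _ = ∑ i ∈ s, (a * (t i : ℤ) + q * (q + 1) * ρ) := by rw [hline m hmn, hline t htn]
    _ = _ := by
        refine sum_congr rfl fun i hi => ?_
        rw [hg]
        rcases ht i hi with h | h <;> simp [h]

/-- The residue classes modulo `r` in `Fin n` have size `(n - 1) / r` or `(n - 1) / r + 1`. -/
theorem card_filter_mod_eq {r n i : ℕ} (hn : 1 ≤ n) (hi : i < r) :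
    #{u : Fin n | (u : ℕ) % r = i} = (n - 1) / r ∨
      #{u : Fin n | (u : ℕ) % r = i} = (n - 1) / r + 1 := by
  have hr : 0 < r := by lia
  have hcard : #{u : Fin n | (u : ℕ) % r = i} = n / r + if i < n % r then 1 else 0 := by
    have h := Nat.count_modEq_card n hr i
    rw [Nat.mod_eq_of_lt hi] at h
    rw [← h, Nat.count_eq_card_filter_range, card_filter, card_filter,
      Fin.sum_univ_eq_sum_range fun u => if u % r = i then 1 else 0]
    simp [Nat.ModEq, Nat.mod_eq_of_lt hi]
  have hdiv : n / r = (n - 1) / r + if r ∣ n then 1 else 0 := by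
    obtain ⟨k, rfl⟩ := Nat.exists_eq_add_of_le' hn
    simpa using Nat.succ_div (a := k) (b := r)
  rw [hcard, hdiv]
  by_cases hd : r ∣ n
  · simp [hd, Nat.mod_eq_zero_of_dvd hd]
  · simp only [hd, if_false, add_zero]
    split_ifs <;> simp

/-- For every integer `r ≥ 2` and every positive integer `n`, the maximum of
`Σ_v C(deg v, 2)` over all `K_{r+1}`-free graphs on `n` vertices equals the
corresponding sum for the Turán graph `T_r(n)`. -/
theorem ex_phi_eq_turan_k_two (r n : ℕ) (hr : 2 ≤ r) (hn : 1 ≤ n) :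
    IsGreatest {m : ℕ | ∃ G : SimpleGraph (Fin n), G.CliqueFree (r + 1) ∧ ePhi G 2 = m}
      (ePhi (SimpleGraph.turanGraph n r) 2) := by
  refine ⟨⟨_, SimpleGraph.turanGraph_cliqueFree (by lia), rfl⟩, ?_⟩
  rintro _ ⟨G, hG, rfl⟩
  obtain ⟨c, hc, hdeg⟩ := exists_coloring_degree_le G r univ hG.cliqueFreeOn
  replace hc : ∀ v, c v < r := fun v => hc v (mem_univ v)
  have hle : ePhi G 2 ≤ ∑ v, (#{u | c u ≠ c v}).choose 2 := by
    refine sum_le_sum fun v _ => Nat.choose_le_choose 2 ?_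
    rw [← SimpleGraph.card_neighborFinset_eq_degree, SimpleGraph.neighborFinset_eq_filter]
    exact hdeg v (mem_univ v)
  refine hle.trans ?_
  have hturan : ePhi (SimpleGraph.turanGraph n r) 2 =
      ∑ v : Fin n, (#{u : Fin n | (u : ℕ) % r ≠ (v : ℕ) % r}).choose 2 := by
    refine sum_congr rfl fun v _ => ?_
    rw [← SimpleGraph.card_neighborFinset_eq_degree, SimpleGraph.neighborFinset_eq_filter]
    simp only [SimpleGraph.turanGraph_adj, ne_comm]
  have hmod (v : Fin n) : (v : ℕ) % r < r := Nat.mod_lt _ (by lia)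
  by_cases hmono : ∃ i, #{u | c u = i} = n
  · obtain ⟨i, hi⟩ := hmono
    have hconst : ∀ u, c u = i := by
      simpa [filter_eq_self] using
        eq_univ_of_card _ (hi.trans (Fintype.card_fin n).symm)
    simp [hconst]
  · have hsum (x : Fin n → ℕ) (hx : ∀ v, x v < r) : ∑ i ∈ range r, #{u | x u = i} = n := by
      rw [← card_eq_sum_card_fiberwise (by simpa [Set.MapsTo] using hx), card_univ,
        Fintype.card_fin]
    have hq : 2 * ((n - 1) / r) + 1 ≤ n := by
      have h1 : (n - 1) / r ≤ (n - 1) / 2 := Nat.div_le_div_left hr (by lia)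
      lia
    have key := sum_mul_sub_mul_sub_le_of_balanced (range r) (n := n) (q := (n - 1) / r)
      (fun i => #{u | c u = i}) (fun i => #{u : Fin n | (u : ℕ) % r = i}) hq
      (fun i _ => by
        have h1 : #{u | c u = i} ≤ n := by simpa using card_le_univ {u | c u = i}
        exact Nat.lt_of_le_of_ne h1 fun h => hmono ⟨i, h⟩)
      (hsum c hc) (hsum _ hmod) (fun i hi => card_filter_mod_eq hn (mem_range.1 hi))
    have hl := two_mul_sum_choose_two_multipartite c hc
    have hR := two_mul_sum_choose_two_multipartite (fun v : Fin n => (v : ℕ) % r) hmod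
    rw [Fintype.card_fin] at hl hR
    rw [← hl, ← hR] at key
    rw [hturan]
    exact_mod_cast le_of_mul_le_mul_left key two_pos
end

section
/- (Erdős degree majorization) Let r ≥ 1 and let G = (V,E) be a simple graph containing no K_{r+1} as a subgraph. Then there exists an r-partite graph G' = (V,E') on the same vertex set (i.e., a graph whose vertex set is partitioned into at most r independent sets) such that d_G(v) ≤ d_{G'}(v) for every vertex v ∈ V. -/
open Finset
open scoped Classical

/-- If every clique of `G` inside `S` has at most `r` vertices, then `S` can be coloured with `r`
colours so that the induced complete multipartite graph on `S` majorizes the degrees of `G`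
restricted to `S`. -/
theorem exists_coloring_card_adj_le {V : Type*} (G : SimpleGraph V) (r : ℕ) (S : Finset V)
    (hS : ∀ s ⊆ S, G.IsClique (s : Set V) → #s ≤ r) :
    ∃ c : V → ℕ, (∀ v ∈ S, c v < r) ∧
      ∀ v ∈ S, #{w ∈ S | G.Adj v w} ≤ #{w ∈ S | c v ≠ c w} := by
  induction r generalizing S with
  | zero =>
    have hempty : ∀ v, v ∉ S := fun v hv => by
      simpa using hS {v} (by simpa using hv) (by simp)
    exact ⟨fun _ => 0, fun v hv => absurd hv (hempty v), fun v hv => absurd hv (hempty v)⟩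
  | succ r ih =>
    obtain rfl | hne := S.eq_empty_or_nonempty
    · exact ⟨fun _ => 0, by simp, by simp⟩
    obtain ⟨x, hx, hmax⟩ := S.exists_max_image (fun v => #{w ∈ S | G.Adj v w}) hne
    set T := {w ∈ S | G.Adj x w}
    have hTS : T ⊆ S := filter_subset _ _
    obtain ⟨c, hc, hdeg⟩ := ih T fun s hs hclique => by
      have hadj : ∀ w ∈ s, G.Adj x w := fun w hw => (mem_filter.1 (hs hw)).2
      have hxs : x ∉ s := fun h => G.irrefl (hadj x h)
      have hcard := hS (insert x s) (insert_subset hx (hs.trans hTS)) (by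
        rw [coe_insert]
        exact hclique.insert fun w hw _ => hadj w hw)
      rw [card_insert_of_notMem hxs] at hcard
      omega
    refine ⟨fun v => if v ∈ T then c v else r, fun v _ => ?_, fun v hv => ?_⟩
    · by_cases hvT : v ∈ T
      · simpa [hvT] using (hc v hvT).trans (Nat.lt_succ_self r)
      · simp [hvT]
    · by_cases hvT : v ∈ T
      · calc #{w ∈ S | G.Adj v w}
            ≤ #({w ∈ T | G.Adj v w} ∪ S \ T) := card_le_card fun w hw => by
              simp only [mem_union, mem_filter, mem_sdiff] at hw ⊢
              tauto
          _ ≤ #{w ∈ T | G.Adj v w} + #(S \ T) := card_union_le _ _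
          _ ≤ #{w ∈ T | c v ≠ c w} + #(S \ T) := Nat.add_le_add_right (hdeg v hvT) _
          _ = #({w ∈ T | c v ≠ c w} ∪ S \ T) :=
              (card_union_of_disjoint (disjoint_sdiff.mono_left (filter_subset _ _))).symm
          _ ≤ _ := card_le_card fun w hw => by
              rw [mem_union, mem_filter, mem_sdiff] at hw
              rw [mem_filter]
              rcases hw with ⟨hwT, hne⟩ | ⟨hwS, hwT⟩
              · exact ⟨hTS hwT, by simpa [hvT, hwT] using hne⟩
              · exact ⟨hwS, by simpa [hvT, hwT] using (hc v hvT).ne⟩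
      · refine (hmax v hv).trans (card_le_card fun w hw => mem_filter.2 ⟨hTS hw, ?_⟩)
        simpa [hvT, show w ∈ T from hw] using (hc w hw).ne'

/-- Erdős degree majorization: if `G` is a `K_{r+1}`-free graph, then there is an
`r`-partite graph `G'` (i.e. an `r`-colorable graph) on the same vertex set such that
every vertex has degree in `G'` at least its degree in `G`. -/
theorem erdos_degree_majorization {V : Type*} [Fintype V] (r : ℕ) (hr : 1 ≤ r)
    (G : SimpleGraph V) (hG : G.CliqueFree (r + 1)) :
    ∃ G' : SimpleGraph V, G'.Colorable r ∧ ∀ v : V, G.degree v ≤ G'.degree v := by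
  obtain ⟨c, hc, hdeg⟩ := exists_coloring_card_adj_le G r univ fun s _ hclique => by
    by_contra! hlt
    exact hG.mono hlt s ⟨hclique, rfl⟩
  refine ⟨(⊤ : SimpleGraph ℕ).comap c,
    ⟨SimpleGraph.Coloring.mk (fun v => (⟨c v, hc v (mem_univ v)⟩ : Fin r)) ?_⟩, fun v => ?_⟩
  · intro v w hvw
    simpa using hvw
  · rw [← SimpleGraph.card_neighborFinset_eq_degree, ← SimpleGraph.card_neighborFinset_eq_degree,
      SimpleGraph.neighborFinset_eq_filter, SimpleGraph.neighborFinset_eq_filter]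
    simpa using hdeg v (mem_univ v)
end

section
/- For every n ≥ r ≥ 1 and every positive integer k, there exists a complete multipartite graph G on n vertices with at most r parts such that e_φ(G) = ex_φ(n, K_{r+1}); that is, the maximum of Σ_v C(d_G(v), k) over all K_{r+1}-free graphs on n vertices is attained by some complete r-partite graph. -/
open Finset
open scoped Classical

/-- Erdős's degree majorization: a graph that is `K_{r+1}`-free on `S` is dominated in degrees,
within `S`, by a complete multipartite graph on `S` with at most `r` parts. -/
theorem SimpleGraph.CliqueFreeOn.exists_degree_majorant {V : Type*} (G : SimpleGraph V)
    (r : ℕ) (S : Finset V) (hS : G.CliqueFreeOn (S : Set V) (r + 1)) :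
    ∃ f : V → ℕ, (∀ u ∈ S, f u < r) ∧
      ∀ u ∈ S, #{w ∈ S | G.Adj u w} ≤ #{w ∈ S | f u ≠ f w} := by
  induction r generalizing S with
  | zero =>
    have hS' : ∀ u, u ∉ S := fun u hu =>
      hS (t := {u}) (by simpa using hu) (by simp [SimpleGraph.isNClique_iff])
    exact ⟨fun _ => 0, fun u hu => absurd hu (hS' u), fun u hu => absurd hu (hS' u)⟩
  | succ r ih =>
    rcases S.eq_empty_or_nonempty with rfl | hne
    · exact ⟨fun _ => 0, by simp, by simp⟩
    obtain ⟨v, hv, hmax⟩ := S.exists_max_image (fun u => #{w ∈ S | G.Adj u w}) hne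
    set N : Finset V := {w ∈ S | G.Adj v w} with hN
    have hNS : N ⊆ S := filter_subset _ _
    have hfree : G.CliqueFreeOn (N : Set V) (r + 1) := by
      intro t ht hclique
      refine hS (t := insert v t) ?_ (hclique.insert fun b hb => ?_)
      · rw [coe_insert, Set.insert_subset_iff]
        exact ⟨hv, ht.trans (coe_subset.2 hNS)⟩
      · exact (mem_filter.1 (ht hb)).2
    obtain ⟨f, hlt, hdeg⟩ := ih N hfree
    refine ⟨fun u => if u ∈ N then f u else r, fun u _ => ?_, fun u hu => ?_⟩
    · dsimp only
      split_ifs with h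
      · exact (hlt u h).trans r.lt_succ_self
      · exact r.lt_succ_self
    by_cases huN : u ∈ N
    · calc #{w ∈ S | G.Adj u w} ≤ #({w ∈ N | G.Adj u w} ∪ (S \ N)) := by
            refine card_le_card fun w hw => ?_
            simp only [mem_filter, mem_union, mem_sdiff] at hw ⊢
            tauto
        _ ≤ #{w ∈ N | G.Adj u w} + #(S \ N) := card_union_le _ _
        _ ≤ #{w ∈ N | f u ≠ f w} + #(S \ N) := Nat.add_le_add_right (hdeg u huN) _
        _ = #({w ∈ N | f u ≠ f w} ∪ (S \ N)) :=
            (card_union_of_disjoint (disjoint_sdiff.mono_left (filter_subset _ _))).symm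
        _ ≤ _ := by
            refine card_le_card fun w hw => ?_
            rcases mem_union.1 hw with hw | hw
            · obtain ⟨hwN, hne⟩ := mem_filter.1 hw
              simpa [huN, hwN, hNS hwN] using hne
            · obtain ⟨hwS, hwN⟩ := mem_sdiff.1 hw
              simpa [huN, hwN, hwS] using (hlt u huN).ne
    · refine (hmax u hu).trans (card_le_card fun w hw => ?_)
      simpa [huN, hw, hNS hw] using (hlt w hw).ne'

theorem ePhi_mono_of_degree_le {V : Type*} [Fintype V] {G H : SimpleGraph V}
    (h : ∀ v, G.degree v ≤ H.degree v) (k : ℕ) : ePhi G k ≤ ePhi H k :=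
  sum_le_sum fun v _ => Nat.choose_le_choose k (h v)

/-- The sum `ePhi` of a `K_{r+1}`-free graph is at most that of some complete multipartite graph
with at most `r` parts. -/
theorem SimpleGraph.CliqueFree.exists_ePhi_le_comap_top {V : Type*} [Fintype V]
    {G : SimpleGraph V} {r : ℕ} (hG : G.CliqueFree (r + 1)) (k : ℕ) :
    ∃ f : V → Fin r, ePhi G k ≤ ePhi ((⊤ : SimpleGraph (Fin r)).comap f) k := by
  obtain ⟨f, hlt, hdeg⟩ :=
    SimpleGraph.CliqueFreeOn.exists_degree_majorant G r univ (hG.cliqueFreeOn)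
  refine ⟨fun u => ⟨f u, hlt u (mem_univ u)⟩, ePhi_mono_of_degree_le (fun u => ?_) k⟩
  rw [← SimpleGraph.card_neighborFinset_eq_degree, ← SimpleGraph.card_neighborFinset_eq_degree,
    SimpleGraph.neighborFinset_eq_filter, SimpleGraph.neighborFinset_eq_filter]
  simpa [Fin.ext_iff] using hdeg u (mem_univ u)

/-- For every `n ≥ r ≥ 1` and `k ≥ 1`, the maximum of `Σ_v C(deg v, k)` over all
`K_{r+1}`-free graphs on `n` vertices is attained by a complete multipartite graph with
at most `r` parts (the comap of the complete graph on `Fin r` along some map). -/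
theorem ex_phi_attained_by_complete_multipartite (n r k : ℕ) (hrn : r ≤ n) (hr : 1 ≤ r)
    (hk : 1 ≤ k) :
    ∃ f : Fin n → Fin r,
      IsGreatest {m : ℕ | ∃ G : SimpleGraph (Fin n), G.CliqueFree (r + 1) ∧ ePhi G k = m}
        (ePhi ((⊤ : SimpleGraph (Fin r)).comap f) k) := by
  have : Nonempty (Fin r) := ⟨⟨0, hr⟩⟩
  obtain ⟨f, hf⟩ := Finite.exists_max
    fun f : Fin n → Fin r => ePhi ((⊤ : SimpleGraph (Fin r)).comap f) k
  refine ⟨f, ⟨_, ?_, rfl⟩, ?_⟩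
  · have hcol : ((⊤ : SimpleGraph (Fin r)).comap f).Colorable r := ⟨⟨f, fun h => h⟩⟩
    exact hcol.cliqueFree r.lt_succ_self
  · rintro _ ⟨G, hG, rfl⟩
    obtain ⟨g, hg⟩ := hG.exists_ePhi_le_comap_top k
    exact hg.trans (hf g)
end

section
/- Let x, y, n be positive integers with y ≥ 1, x ≥ y + 2, and n ≥ x + y. Then (y+1)·C(n−y−1, 2) + (x−1)·C(n−x+1, 2) > y·C(n−y, 2) + x·C(n−x, 2). (This is the key inequality in the proof of Theorem 1: transferring one vertex from a vertex class of size x to a class of size y in a complete multipartite graph strictly increases Σ_v C(d(v), 2) when x − y > 1.) -/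
/-- Transferring a vertex from a class of size `x` to a class of size `y` with `x ≥ y + 2`
strictly increases `Σ_v C(deg v, 2)` in a complete multipartite graph:
`(y+1)·C(n−y−1,2) + (x−1)·C(n−x+1,2) > y·C(n−y,2) + x·C(n−x,2)`. -/
theorem transfer_increases_choose_two (x y n : ℕ) (hy : 1 ≤ y) (hx : y + 2 ≤ x)
    (hn : x + y ≤ n) :
    y * Nat.choose (n - y) 2 + x * Nat.choose (n - x) 2 <
      (y + 1) * Nat.choose (n - y - 1) 2 + (x - 1) * Nat.choose (n - x + 1) 2 := by
  obtain ⟨k, rfl⟩ := Nat.exists_eq_add_of_le hx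
  obtain ⟨m, rfl⟩ := Nat.exists_eq_add_of_le hn
  have h₁ : y + 2 + k + y + m - y = y + 2 + k + m := by omega
  have h₂ : y + 2 + k + y + m - (y + 2 + k) = y + m := by omega
  have h₃ : y + 2 + k + m - 1 = y + 1 + k + m := by omega
  have h₄ : y + 2 + k - 1 = y + 1 + k := by omega
  rw [h₁, h₂, h₃, h₄, ← Nat.cast_lt (α := ℚ)]
  push_cast [Nat.cast_choose_two]
  have hy' : (1 : ℚ) ≤ y := by exact_mod_cast hy
  have hpos : (0 : ℚ) < (k + 1) * (y + 2 * m + k / 2) := by positivity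
  linarith
end

section
/- For every even integer n ≥ 8, the slightly unbalanced complete bipartite graph beats the balanced one for k = 3: (n/2 − 1)·C(n/2 + 1, 3) + (n/2 + 1)·C(n/2 − 1, 3) > n·C(n/2, 3). Equivalently, e_φ(K_{n/2−1, n/2+1}) > e_φ(T_2(n)) for k = 3, showing that the identity ex_φ(n,K_{r+1}) = e_φ(T_r(n)) of Theorem 1 fails for k ≥ 3. -/
theorem two_mul_choose_two_add_self (k : ℕ) : 2 * k.choose 2 + k = k ^ 2 := by
  induction k with
  | zero => rfl
  | succ k ih =>
    have h : (k + 1).choose 2 = k + k.choose 2 := by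
      rw [Nat.choose_succ_succ' k 1, Nat.choose_one_right]
    rw [h]
    linarith

/-- For every even `n ≥ 8`, the slightly unbalanced complete bipartite graph beats the
balanced one for `k = 3`:
`(n/2 − 1)·C(n/2 + 1, 3) + (n/2 + 1)·C(n/2 − 1, 3) > n·C(n/2, 3)`. -/
theorem unbalanced_beats_balanced_k_three (n : ℕ) (hn : 8 ≤ n) (he : Even n) :
    n * Nat.choose (n / 2) 3 <
      (n / 2 - 1) * Nat.choose (n / 2 + 1) 3 + (n / 2 + 1) * Nat.choose (n / 2 - 1) 3 := by
  obtain ⟨k, rfl⟩ : ∃ k, n = 2 * (k + 1) := by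
    obtain ⟨m, rfl⟩ := he
    exact ⟨m - 1, by omega⟩
  rw [Nat.mul_div_cancel_left _ two_pos, Nat.add_sub_cancel]
  have h₃ : (k + 1).choose 3 = k.choose 2 + k.choose 3 := Nat.choose_succ_succ' k 2
  have h₄ : (k + 1 + 1).choose 3 = k + 2 * k.choose 2 + k.choose 3 := by
    rw [Nat.choose_succ_succ' (k + 1) 2, h₃, Nat.choose_succ_succ' k 1, Nat.choose_one_right]
    ring
  have h₂ := two_mul_choose_two_add_self k
  rw [h₃, h₄]
  nlinarith
end

section
/- Let r ≥ 1 and let H be a graph with chromatic number χ(H) = r + 1. For every ε > 0 there exists N such that every H-free graph G on n ≥ N vertices contains a spanning subgraph G'' which is K_{r+1}-free and satisfies e(G) − e(G'') ≤ ε·n²; that is, G can be made K_{r+1}-free by removing at most ε·n² edges. -/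
open Finset
open scoped Classical

/-- `G` contains a copy of `H` as a subgraph (an injective graph homomorphism). -/
def ContainsCopy {α β : Type*} (H : SimpleGraph α) (G : SimpleGraph β) : Prop :=
  ∃ f : α → β, Function.Injective f ∧ ∀ a b, H.Adj a b → G.Adj (f a) (f b)

namespace SimpleGraph

variable {V : Type*} [DecidableEq V] {G : SimpleGraph V} [DecidableRel G.Adj]

/-- Fewer than a proportion `η` of the vertices of one side of an `η`-uniform pair of density at
least `2 * θ` have fewer than `θ * #t` neighbours in a large subset `t` of the other side. -/
lemma IsUniform.card_filter_lt {η θ : ℝ} {A B s t : Finset V} (h : G.IsUniform η A B)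
    (hηθ : η ≤ θ) (hd : 2 * θ ≤ G.edgeDensity A B) (hs : s ⊆ A) (ht : t ⊆ B)
    (hsize : #B * η ≤ #t) :
    (#{v ∈ s | (#{y ∈ t | G.Adj v y} : ℝ) < θ * #t} : ℝ) < #A * η := by
  by_contra! hcon
  set b : Finset V := {v ∈ s | (#{y ∈ t | G.Adj v y} : ℝ) < θ * #t} with hb
  have hη : 0 < η := h.pos
  have key := h ((filter_subset _ _).trans hs) ht hcon hsize
  have hcard : (#(G.interedges b t) : ℝ) ≤ #b * (θ * #t) := by
    refine (Nat.cast_le.2 <| (card_le_card <| subset_of_eq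
      (Rel.interedges_eq_biUnion (r := G.Adj))).trans card_biUnion_le).trans ?_
    simp_rw [Nat.cast_sum, card_map, ← nsmul_eq_mul (#b)]
    exact sum_le_card_nsmul _ _ _ fun x hx ↦ (mem_filter.1 hx).2.le
  have hdens : (G.edgeDensity b t : ℝ) ≤ θ := by
    rw [edgeDensity_def]
    push_cast
    refine div_le_of_le_mul₀ (by positivity) (by linarith) ?_
    linarith
  rw [abs_sub_lt_iff] at key
  linarith

/-- Greedy form of the **graph embedding lemma**: the vertices in `T` of a graph `H` can be
embedded in `G` avoiding `U`, each vertex `x` inside a prescribed set `S x` of candidates which is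
not too small in the cell `P x`, when the cells form uniform and dense pairs along edges of `H`. -/
lemma exists_partial_copy_of_isUniform {α : Type*} [DecidableEq α] {H : SimpleGraph α}
    {P : α → Finset V} {η θ c : ℝ} {h : ℕ} (hθ : 0 < θ) (hθ1 : θ ≤ 1) (hη : 0 < η) (hηθ : η ≤ θ)
    (hηc : η ≤ c) (hne : ∀ x, (P x).Nonempty) (hP : ∀ x, h * (#(P x) * η) + h < c * #(P x))
    (hunif : ∀ x y, H.Adj x y → G.IsUniform η (P x) (P y))
    (hdens : ∀ x y, H.Adj x y → 2 * θ ≤ G.edgeDensity (P x) (P y)) (T : Finset α) :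
    ∀ (U : Finset V) (S : α → Finset V), #U + #T ≤ h → (∀ x ∈ T, S x ⊆ P x) →
      (∀ x ∈ T, c * #(P x) ≤ θ ^ #T * #(S x)) →
      ∃ f : α → V, (∀ x ∈ T, f x ∈ S x ∧ f x ∉ U) ∧ Set.InjOn f T ∧
        ∀ x ∈ T, ∀ y ∈ T, H.Adj x y → G.Adj (f x) (f y) := by
  induction T using Finset.induction_on with
  | empty =>
    intro U S _ _ _
    by_cases hα : Nonempty α
    · exact ⟨fun x ↦ (hne x).choose, by simp, by simp, by simp⟩
    · exact ⟨fun x ↦ (hα ⟨x⟩).elim, by simp, by simp, by simp⟩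
  | insert x T hxT ih =>
    intro U S hUT hSP hSc
    have hlarge : ∀ y ∈ insert x T, c * #(P y) ≤ #(S y) := fun y hy ↦
      (hSc y hy).trans (mul_le_of_le_one_left (by positivity) (pow_le_one₀ hθ.le hθ1))
    have hηS : ∀ y ∈ insert x T, #(P y) * η ≤ #(S y) := fun y hy ↦
      le_trans (by rw [mul_comm]; gcongr) (hlarge y hy)
    let bad : α → Finset V := fun y ↦
      {v ∈ S x | (#{w ∈ S y | G.Adj v w} : ℝ) < θ * #(S y)}
    have hbad : ∀ y ∈ T.filter (H.Adj x), (#(bad y) : ℝ) ≤ #(P x) * η := by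
      intro y hy
      obtain ⟨hyT, hxy⟩ := mem_filter.1 hy
      exact ((hunif x y hxy).card_filter_lt hηθ (hdens x y hxy) (hSP x (mem_insert_self _ _))
        (hSP y (mem_insert_of_mem hyT)) (hηS y (mem_insert_of_mem hyT))).le
    rw [card_insert_of_notMem hxT] at hUT
    obtain ⟨v, hvS, hv⟩ : ∃ v ∈ S x, v ∉ (T.filter (H.Adj x)).biUnion bad ∪ U := by
      by_contra! hsub
      have h1 : (#(S x) : ℝ) ≤ #((T.filter (H.Adj x)).biUnion bad) + #U :=
        mod_cast (card_le_card hsub).trans (card_union_le _ _)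
      have h2 : (#((T.filter (H.Adj x)).biUnion bad) : ℝ) ≤ #T * (#(P x) * η) := by
        calc (#((T.filter (H.Adj x)).biUnion bad) : ℝ)
            ≤ ∑ y ∈ T.filter (H.Adj x), (#(bad y) : ℝ) := mod_cast card_biUnion_le
          _ ≤ #(T.filter (H.Adj x)) • (#(P x) * η) := sum_le_card_nsmul _ _ _ hbad
          _ ≤ #T * (#(P x) * η) := by
              rw [nsmul_eq_mul]
              gcongr
              exact filter_subset _ _
      have h3 : (#T : ℝ) ≤ h := mod_cast (by omega : #T ≤ h)
      have h4 : (#U : ℝ) ≤ h := mod_cast (by omega : #U ≤ h)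
      have h5 : (#T : ℝ) * (#(P x) * η) ≤ h * (#(P x) * η) := by gcongr
      linarith [hP x, hlarge x (mem_insert_self _ _)]
    simp only [mem_union, mem_biUnion, mem_filter, not_or, not_exists, not_and, bad, not_lt,
      and_imp] at hv
    obtain ⟨hvbad, hvU⟩ := hv
    let S' : α → Finset V := fun y ↦ if H.Adj x y then {w ∈ S y | G.Adj v w} else S y
    have hS'S : ∀ y, S' y ⊆ S y := by
      intro y
      dsimp only [S']
      split_ifs
      · exact filter_subset _ _
      · exact Subset.rfl
    have hS'θ : ∀ y ∈ T, θ * #(S y) ≤ #(S' y) := by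
      intro y hy
      dsimp only [S']
      split_ifs with hxy
      · exact hvbad y hy hxy hvS
      · exact mul_le_of_le_one_left (by positivity) hθ1
    obtain ⟨f, hf, hinj, hadj⟩ := ih (insert v U) S'
      (by have := card_insert_le v U; omega)
      (fun y hy ↦ (hS'S y).trans (hSP y (mem_insert_of_mem hy)))
      (fun y hy ↦ by
        have h1 := hSc y (mem_insert_of_mem hy)
        rw [card_insert_of_notMem hxT, pow_succ, mul_assoc] at h1
        exact h1.trans (mul_le_mul_of_nonneg_left (hS'θ y hy) (by positivity)))
    have hfne : ∀ y ∈ T, f y ≠ v := fun y hy he ↦ (hf y hy).2 (he ▸ mem_insert_self _ _)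
    have hnbr : ∀ y ∈ T, H.Adj x y → G.Adj v (f y) := by
      intro y hy hxy
      have := (hf y hy).1
      simp only [S', hxy, if_true, mem_filter] at this
      exact this.2
    have hupd : ∀ y ∈ T, Function.update f x v y = f y := fun y hy ↦
      Function.update_of_ne (ne_of_mem_of_not_mem hy hxT) _ _
    refine ⟨Function.update f x v, ?_, ?_, ?_⟩
    · intro y hy
      obtain rfl | hy := mem_insert.1 hy
      · simpa using ⟨hvS, hvU⟩
      · rw [hupd y hy]
        exact ⟨hS'S y (hf y hy).1, fun hU ↦ (hf y hy).2 (mem_insert_of_mem hU)⟩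
    · rw [coe_insert, Set.injOn_insert (by simpa using hxT)]
      refine ⟨hinj.congr fun y hy ↦ (hupd y hy).symm, ?_⟩
      rintro ⟨y, hy, he⟩
      rw [hupd y hy, Function.update_self] at he
      exact hfne y hy he
    · intro y hyT z hzT hyz
      obtain rfl | hy := mem_insert.1 hyT
      · obtain rfl | hz := mem_insert.1 hzT
        · exact (H.irrefl hyz).elim
        · rw [hupd z hz, Function.update_self]
          exact hnbr z hz hyz
      · obtain rfl | hz := mem_insert.1 hzT
        · rw [hupd y hy, Function.update_self]
          exact (hnbr y hy hyz.symm).symm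
        · rw [hupd y hy, hupd z hz]
          exact hadj y hy z hz hyz

variable [Fintype V] {P : Finpartition (univ : Finset V)} {η ε : ℝ}

lemma filter_adj_not_regularityReduced_subset (η δ : ℝ) :
    (univ : Finset (V × V)).filter
        (fun (x, y) ↦ G.Adj x y ∧ ¬ (G.regularityReduced P η δ).Adj x y) ⊆
      (P.nonUniforms G η).biUnion (fun (U, V) ↦ U ×ˢ V) ∪ P.parts.biUnion offDiag ∪
        (P.sparsePairs G δ).biUnion fun (U, V) ↦ G.interedges U V := by
  rintro ⟨x, y⟩
  simp only [mem_filter, mem_univ, true_and, regularityReduced_adj, not_and, not_exists,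
    not_le, mem_biUnion, mem_union, mem_product, Prod.exists, mem_offDiag, and_imp,
    or_assoc, and_assoc, P.mk_mem_nonUniforms, Finpartition.mk_mem_sparsePairs, mem_interedges_iff]
  intro h h'
  replace h' := h' h
  obtain ⟨U, hU, hx⟩ := P.exists_mem (mem_univ x)
  obtain ⟨W, hW, hy⟩ := P.exists_mem (mem_univ y)
  obtain rfl | hUW := eq_or_ne U W
  · exact Or.inr (Or.inl ⟨U, hU, hx, hy, G.ne_of_adj h⟩)
  by_cases h₂ : G.IsUniform η U W
  · exact Or.inr <| Or.inr ⟨U, W, hU, hW, hUW, h' _ hU _ hW hx hy hUW h₂, hx, hy, h⟩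
  · exact Or.inl ⟨U, W, hU, hW, hUW, h₂, hx, hy⟩

/-- Passing to the reduced graph of a sufficiently fine uniform equipartition loses few edges. -/
lemma card_edgeFinset_sub_regularityReduced_le [Nonempty V] (hη : 0 < η) (hηε : η ≤ ε / 8)
    (hP : P.IsEquipartition) (hPη : P.IsUniform G η) (hP' : 4 / ε ≤ #P.parts) :
    (#G.edgeFinset - #(G.regularityReduced P η (ε / 4)).edgeFinset : ℝ)
      ≤ ε * (Fintype.card V : ℝ) ^ 2 := by
  have hε : 0 < ε := by linarith
  let A := (P.nonUniforms G η).biUnion fun (U, V) ↦ U ×ˢ V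
  let B := P.parts.biUnion offDiag
  let C := (P.sparsePairs G (ε / 4)).biUnion fun (U, V) ↦ G.interedges U V
  have hA : (#A : ℝ) ≤ 4 * η * (#(univ : Finset V) : ℝ) ^ 2 :=
    (hP.sum_nonUniforms_lt univ_nonempty hη hPη).le
  have hB : (#B : ℝ) ≤ ε / 2 * (#(univ : Finset V) : ℝ) ^ 2 := hP.card_biUnion_offDiag_le hε hP'
  have hC : (#C : ℝ) ≤ 4 * (ε / 4) * (#(univ : Finset V) : ℝ) ^ 2 :=
    hP.card_interedges_sparsePairs_le (G := G) (ε := ε / 4) (by positivity)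
  rw [card_univ] at hA hB hC
  have hABC : (2 * (#G.edgeFinset - #(G.regularityReduced P η (ε / 4)).edgeFinset) : ℝ)
      ≤ #A + #B + #C := by
    calc
      _ = (#((univ ×ˢ univ).filter fun (x, y) ↦
            G.Adj x y ∧ ¬(G.regularityReduced P η (ε / 4)).Adj x y) : ℝ) := by
        rw [univ_product_univ, mul_sub, filter_and_not, cast_card_sdiff]
        · norm_cast
          rw [two_mul_card_edgeFinset, two_mul_card_edgeFinset]
        · gcongr with xy _
          exact fun hxy ↦ regularityReduced_le hxy
      _ ≤ #(A ∪ B ∪ C) := by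
        rw [univ_product_univ]; gcongr; exact filter_adj_not_regularityReduced_subset η (ε / 4)
      _ ≤ #(A ∪ B) + #C := mod_cast (card_union_le _ _)
      _ ≤ #A + #B + #C := by gcongr; exact mod_cast card_union_le _ _
  have : 4 * η * (Fintype.card V : ℝ) ^ 2 ≤ ε / 2 * (Fintype.card V : ℝ) ^ 2 := by
    gcongr; linarith
  linarith

/-- If the reduced graph of a partition into large parts contains `K_k`, then the original graph
contains every given `k`-colorable graph. -/
lemma isContained_of_not_cliqueFree_regularityReduced {α : Type*} [Fintype α] {H : SimpleGraph α}
    {k : ℕ} (C : H.Coloring (Fin k)) {θ c : ℝ} (hθ : 0 < θ) (hθ1 : θ ≤ 1) (hη : 0 < η)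
    (hηθ : η ≤ θ) (hc : c = θ ^ Fintype.card α) (hηc : η ≤ c)
    (hP : ∀ s ∈ P.parts, Fintype.card α * (#s * η) + Fintype.card α < c * #s)
    (hK : ¬ (G.regularityReduced P η (2 * θ)).CliqueFree k) : H ⊑ G := by
  classical
  rw [not_cliqueFree_iff_top_isContained] at hK
  obtain ⟨g⟩ := hK
  have hadj : ∀ x y, H.Adj x y →
      G.IsUniform η (P.part (g (C x))) (P.part (g (C y))) ∧
        2 * θ ≤ G.edgeDensity (P.part (g (C x))) (P.part (g (C y))) := by
    intro x y hxy
    have : (G.regularityReduced P η (2 * θ)).Adj (g (C x)) (g (C y)) :=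
      g.toHom.map_adj (C.valid hxy)
    obtain ⟨-, U, hU, W, hW, hxU, hyW, -, hunif, hdens⟩ := this
    rw [P.part_eq_of_mem hU hxU, P.part_eq_of_mem hW hyW]
    exact ⟨hunif, hdens⟩
  obtain ⟨f, -, hinj, hf⟩ := exists_partial_copy_of_isUniform (G := G) (H := H)
    (P := fun x ↦ P.part (g (C x))) hθ hθ1 hη hηθ hηc
    (fun x ↦ ⟨_, P.mem_part (mem_univ _)⟩) (fun x ↦ hP _ (P.part_mem.2 (mem_univ _)))
    (fun x y hxy ↦ (hadj x y hxy).1) (fun x y hxy ↦ (hadj x y hxy).2) univ ∅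
    (fun x ↦ P.part (g (C x))) (by simp) (fun _ _ ↦ Subset.rfl)
    (fun x _ ↦ by rw [card_univ, hc])
  exact ⟨⟨⟨f, fun {a b} hab ↦ hf a (mem_univ a) b (mem_univ b) hab⟩,
    fun a b hab ↦ hinj (mem_coe.2 (mem_univ a)) (mem_coe.2 (mem_univ b)) hab⟩⟩

end SimpleGraph

/-- If `H` has chromatic number `r + 1`, then for every `ε > 0` every `H`-free graph on
sufficiently many vertices `n` can be made `K_{r+1}`-free by removing at most `ε·n²`
edges. -/
theorem make_clique_free_by_removing_few_edges {α : Type*} [Fintype α] (r : ℕ)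
    (hr : 1 ≤ r) (H : SimpleGraph α) (hchrom : H.chromaticNumber = (r + 1 : ℕ)) :
    ∀ ε : ℝ, 0 < ε → ∃ N : ℕ, ∀ n : ℕ, N ≤ n → ∀ G : SimpleGraph (Fin n),
      ¬ ContainsCopy H G →
        ∃ G'' ≤ G, G''.CliqueFree (r + 1) ∧
          (G.edgeFinset.card : ℝ) - (G''.edgeFinset.card : ℝ) ≤ ε * (n : ℝ) ^ 2 := by
  intro ε₀ hε₀
  obtain ⟨C⟩ : H.Colorable (r + 1) := SimpleGraph.chromaticNumber_le_iff_colorable.1 hchrom.le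
  set h := Fintype.card α
  set ε := min ε₀ 1
  have hε : 0 < ε := lt_min hε₀ one_pos
  have hε1 : ε ≤ 1 := min_le_right _ _
  set θ := ε / 8
  have hθ : 0 < θ := by positivity
  have hθ1 : θ ≤ 1 := by dsimp only [θ]; linarith
  set c := θ ^ h
  have hc : 0 < c := by positivity
  set η := min θ (c / (2 * h + 1))
  have hη : 0 < η := lt_min hθ (by positivity)
  have hηθ : η ≤ θ := min_le_left _ _
  have hηc' : η * (2 * h + 1) ≤ c := (le_div_iff₀ (by positivity)).1 (min_le_right _ _)
  have hηc : η ≤ c := by nlinarith [mul_nonneg hη.le (Nat.cast_nonneg (α := ℝ) h)]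
  set l := ⌈4 / ε⌉₊
  set M := SzemerediRegularity.bound η l
  obtain ⟨K, hK⟩ := exists_nat_gt (2 * h / c)
  have hM : 0 < M := SzemerediRegularity.bound_pos _ _
  refine ⟨l + M * (K + 1), fun n hn G hG ↦ ?_⟩
  have hMn : M * (K + 1) ≤ n := by omega
  have hn0 : 0 < n := lt_of_lt_of_le (by positivity) hMn
  have : Nonempty (Fin n) := ⟨⟨0, hn0⟩⟩
  obtain ⟨P, hP, hlP, hPM, hPη⟩ := szemeredi_regularity G hη
    (show l ≤ Fintype.card (Fin n) by rw [Fintype.card_fin]; omega)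
  have hlarge : ∀ s ∈ P.parts, (h : ℝ) * (#s * η) + h < c * #s := by
    intro s hs
    have hsK : K ≤ #s := by
      have h1 := hP.average_le_card_part hs
      have h2 : K + 1 ≤ n / #P.parts := by
        rw [Nat.le_div_iff_mul_le (card_pos.2 ⟨s, hs⟩)]
        calc (K + 1) * #P.parts ≤ (K + 1) * M := by gcongr
          _ ≤ n := by rwa [mul_comm]
      rw [card_univ, Fintype.card_fin] at h1
      omega
    have h3 : 2 * h / c < (#s : ℝ) := hK.trans_le (mod_cast hsK)
    rw [div_lt_iff₀ hc] at h3
    have h4 := mul_le_mul_of_nonneg_right hηc' (Nat.cast_nonneg (α := ℝ) #s)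
    have h5 : 0 < η * #s :=
      mul_pos hη (mod_cast card_pos.2 (P.nonempty_of_mem_parts hs))
    nlinarith
  refine ⟨G.regularityReduced P η (ε / 4), SimpleGraph.regularityReduced_le, ?_, ?_⟩
  · by_contra hcl
    rw [show ε / 4 = 2 * θ by ring] at hcl
    obtain ⟨f⟩ := SimpleGraph.isContained_of_not_cliqueFree_regularityReduced C hθ hθ1 hη hηθ
      rfl hηc hlarge hcl
    exact hG ⟨f, f.injective, fun a b hab ↦ f.toHom.map_adj hab⟩
  · have h1 := SimpleGraph.card_edgeFinset_sub_regularityReduced_le (G := G) hη hηθ hP hPη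
      ((Nat.le_ceil _).trans (Nat.cast_le.2 hlP))
    rw [Fintype.card_fin] at h1
    have h2 : ε * (n : ℝ) ^ 2 ≤ ε₀ * (n : ℝ) ^ 2 := by
      gcongr
      exact min_le_left _ _
    refine (le_of_eq ?_).trans (h1.trans h2)
    congr!
end

section
/- Let r ≥ 2, let k be a positive integer, and let H be a graph with chromatic number χ(H) = r + 1. Then for every n, ex_φ(n, H) ≥ ex_φ(n, K_{r+1}); that is, the maximum of Σ_v C(d(v), k) over H-free graphs on n vertices is at least its maximum over K_{r+1}-free graphs on n vertices. -/
open Finset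
open scoped Classical

/-- `ex_φ(n, H)`: the maximum of `e_φ(G)` over `H`-free graphs `G` on `n` vertices. -/
noncomputable def exPhi (n k : ℕ) {α : Type*} (H : SimpleGraph α) : ℕ :=
  sSup {m : ℕ | ∃ G : SimpleGraph (Fin n), ¬ ContainsCopy H G ∧ ePhi G k = m}

/-- Erdős's degree majorization: a set `S` spanning no `(r + 1)`-clique of `G` can be split into `r`
classes so that every degree inside `S` is at most the degree in the complete multipartite graph
on these classes. -/
theorem exists_partition_degree_le {V : Type*} (G : SimpleGraph V) (r : ℕ) (S : Finset V)
    (h : ∀ t ⊆ S, ¬ G.IsNClique (r + 1) t) :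
    ∃ c : V → ℕ, (∀ v ∈ S, c v < r) ∧
      ∀ v ∈ S, #{w ∈ S | G.Adj v w} ≤ #{w ∈ S | c w ≠ c v} := by
  induction r generalizing S with
  | zero =>
    have hS : ∀ v, v ∉ S := fun v hv =>
      h {v} (by simpa using hv) (by simp [SimpleGraph.isNClique_iff])
    exact ⟨fun _ => 0, fun v hv => (hS v hv).elim, fun v hv => (hS v hv).elim⟩
  | succ r ih =>
    rcases S.eq_empty_or_nonempty with rfl | hne
    · exact ⟨fun _ => 0, by simp, by simp⟩
    obtain ⟨x, hx, hmax⟩ := S.exists_max_image (fun v => #{w ∈ S | G.Adj v w}) hne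
    set N := {w ∈ S | G.Adj x w} with hN
    obtain ⟨c, hc, hdeg⟩ := ih N (fun t ht hclique => by
      refine h (insert x t) (insert_subset hx (ht.trans (filter_subset _ _))) (hclique.insert ?_)
      intro b hb
      exact (mem_filter.1 (ht hb)).2)
    refine ⟨fun v => if v ∈ N then c v else r, ?_, ?_⟩
    · intro v _
      by_cases hv : v ∈ N
      · simpa [hv] using (hc v hv).trans (Nat.lt_succ_self r)
      · simp [hv]
    · intro v hv
      by_cases hvN : v ∈ N
      · have hdisj : Disjoint {w ∈ N | c w ≠ c v} (S \ N) :=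
          disjoint_sdiff.mono_left (filter_subset _ _)
        calc #{w ∈ S | G.Adj v w} ≤ #({w ∈ N | G.Adj v w} ∪ (S \ N)) := by
              apply card_le_card
              intro w hw
              simp only [mem_filter, mem_union, mem_sdiff] at hw ⊢
              tauto
          _ ≤ #{w ∈ N | G.Adj v w} + #(S \ N) := card_union_le _ _
          _ ≤ #{w ∈ N | c w ≠ c v} + #(S \ N) := Nat.add_le_add_right (hdeg v hvN) _
          _ = #({w ∈ N | c w ≠ c v} ∪ (S \ N)) := (card_union_of_disjoint hdisj).symm
          _ ≤ _ := by
              apply card_le_card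
              intro w hw
              rcases mem_union.1 hw with hw | hw
              · obtain ⟨hwN, hne⟩ := mem_filter.1 hw
                exact mem_filter.2 ⟨(mem_filter.1 hwN).1, by simpa [hwN, hvN] using hne⟩
              · obtain ⟨hwS, hwN⟩ := mem_sdiff.1 hw
                exact mem_filter.2 ⟨hwS, by simpa [hwN, hvN] using (hc v hvN).ne'⟩
      · refine (hmax v hv).trans (card_le_card ?_)
        intro w hwN
        exact mem_filter.2 ⟨(mem_filter.1 hwN).1, by
          have hwN' : w ∈ N := hwN
          simpa [hwN', hvN] using (hc w hwN').ne⟩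

/-- Every `K_{r+1}`-free graph is dominated degree by degree by an `r`-colorable graph. -/
theorem exists_colorable_degree_le {V : Type*} [Fintype V] (G : SimpleGraph V) (r : ℕ)
    (h : G.CliqueFree (r + 1)) :
    ∃ G' : SimpleGraph V, G'.Colorable r ∧ ∀ v, G.degree v ≤ G'.degree v := by
  obtain ⟨c, hc, hdeg⟩ := exists_partition_degree_le G r univ (fun t _ => h t)
  let G' : SimpleGraph V := (⊤ : SimpleGraph ℕ).comap c
  refine ⟨G', ⟨SimpleGraph.Coloring.mk (fun v => (⟨c v, hc v (mem_univ v)⟩ : Fin r)) ?_⟩, ?_⟩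
  · intro v w hvw heq
    exact hvw (congrArg Fin.val heq)
  · intro v
    have hG' (_ : Fintype (G'.neighborSet v)) : G'.degree v = #{w | c w ≠ c v} := by
      rw [← G'.card_neighborFinset_eq_degree]
      congr 1
      ext w
      simp [G', ne_comm]
    rw [hG', ← G.card_neighborFinset_eq_degree, G.neighborFinset_eq_filter]
    exact hdeg v (mem_univ v)

/-- The values `ePhi G k` are bounded for fixed `n`, so the supremum in `exPhi` is a maximum. -/
theorem bddAbove_ePhi (n k : ℕ) (P : SimpleGraph (Fin n) → Prop) :
    BddAbove {m : ℕ | ∃ G : SimpleGraph (Fin n), P G ∧ ePhi G k = m} :=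
  ((Set.finite_range fun G : SimpleGraph (Fin n) => ePhi G k).subset
    (by rintro m ⟨G, _, rfl⟩; exact ⟨G, rfl⟩)).bddAbove

/-- If `χ(H) = r + 1` with `r ≥ 2`, then `ex_φ(n, H) ≥ ex_φ(n, K_{r+1})` for every `n`. -/
theorem ex_phi_H_ge_ex_phi_clique {α : Type*} [Fintype α] (r k : ℕ) (hr : 2 ≤ r)
    (hk : 1 ≤ k) (H : SimpleGraph α) (hchrom : H.chromaticNumber = (r + 1 : ℕ)) (n : ℕ) :
    exPhi n k (⊤ : SimpleGraph (Fin (r + 1))) ≤ exPhi n k H := by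
  apply csSup_le
  · refine ⟨_, ⊥, ?_, rfl⟩
    rintro ⟨f, -, hf⟩
    exact hf 0 (Fin.last r) (by simp [Fin.ext_iff]; omega)
  · rintro m ⟨G, hG, rfl⟩
    have hfree : G.CliqueFree (r + 1) := by
      rw [SimpleGraph.cliqueFree_iff]
      exact ⟨fun f => hG ⟨f, f.injective, fun _ _ hab => f.toHom.map_adj hab⟩⟩
    obtain ⟨G', hcol, hdeg⟩ := exists_colorable_degree_le G r hfree
    have hG' : ¬ ContainsCopy H G' := by
      rintro ⟨f, -, hf⟩
      have hH : H.Colorable r := hcol.of_hom ⟨f, fun {a b} hab => hf a b hab⟩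
      have hle := hH.chromaticNumber_le
      rw [hchrom] at hle
      have : r + 1 ≤ r := by exact_mod_cast hle
      omega
    calc ePhi G k ≤ ePhi G' k := sum_le_sum fun v _ => Nat.choose_le_choose k (hdeg v)
      _ ≤ exPhi n k H := le_csSup (bddAbove_ePhi n k _) ⟨G', hG', rfl⟩
end

section
/- Let k ≥ 1 be an integer and let d'' ≤ d' be natural numbers. Then C(d', k) − C(d'', k) ≤ k·(d' − d'')·(e/k)^k·(d')^{k−1}, where e is Euler's number. (This is the bound on the change of Σ_v C(d(v), k) under edge deletion used in the proof of Theorem 3.) -/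
theorem Nat.choose_succ_le_add_mul_choose {a b : ℕ} (m : ℕ) (h : b ≤ a) :
    a.choose (m + 1) ≤ b.choose (m + 1) + (a - b) * a.choose m := by
  induction a, h using Nat.le_induction with
  | base => simp
  | succ n hn ih =>
    have hmono : n.choose m ≤ (n + 1).choose m := Nat.choose_le_choose m n.le_succ
    have hmul := Nat.mul_le_mul_left (n - b) hmono
    rw [Nat.choose_succ_succ' n m, Nat.succ_sub hn, Nat.succ_mul]
    omega

theorem Nat.inv_factorial_le_exp_one_div_pow {k : ℕ} (hk : 1 ≤ k) :
    ((k.factorial : ℝ))⁻¹ ≤ (Real.exp 1 / k) ^ k := by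
  have hk0 : (0 : ℝ) < k := by exact_mod_cast hk
  have h := Real.pow_div_factorial_le_exp (k : ℝ) hk0.le k
  rw [div_pow, ← Real.exp_nat_mul, mul_one, le_div_iff₀ (by positivity), mul_comm]
  exact h

/-- For `k ≥ 1` and naturals `d'' ≤ d'`,
`C(d',k) − C(d'',k) ≤ k·(d'−d'')·(e/k)^k·(d')^{k−1}` where `e` is Euler's number. -/
theorem choose_difference_bound (k d' d'' : ℕ) (hk : 1 ≤ k) (h : d'' ≤ d') :
    (d'.choose k : ℝ) - (d''.choose k : ℝ) ≤
      (k : ℝ) * ((d' : ℝ) - (d'' : ℝ)) * (Real.exp 1 / (k : ℝ)) ^ k *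
        (d' : ℝ) ^ (k - 1) := by
  obtain ⟨m, rfl⟩ : ∃ m, k = m + 1 := ⟨k - 1, by omega⟩
  have hdiff : (d'.choose (m + 1) : ℝ) ≤
      d''.choose (m + 1) + ((d' : ℝ) - d'') * d'.choose m := by
    rw [← Nat.cast_sub h]
    exact_mod_cast Nat.choose_succ_le_add_mul_choose m h
  have hd : (0 : ℝ) ≤ (d' : ℝ) - d'' := sub_nonneg.mpr (by exact_mod_cast h)
  calc (d'.choose (m + 1) : ℝ) - d''.choose (m + 1)
      ≤ ((d' : ℝ) - d'') * d'.choose m := by linarith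
    _ ≤ ((d' : ℝ) - d'') * ((d' : ℝ) ^ m / m.factorial) := by
        gcongr
        exact Nat.choose_le_pow_div m d'
    _ = ((m + 1 : ℕ) : ℝ) * ((d' : ℝ) - d'') * ((m + 1).factorial : ℝ)⁻¹ * (d' : ℝ) ^ m := by
        rw [Nat.factorial_succ]
        push_cast
        field_simp
    _ ≤ _ := by
        rw [Nat.add_sub_cancel]
        gcongr
        exact Nat.inv_factorial_le_exp_one_div_pow hk
end
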